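/- Let q ≥ 2 be an integer. There exists a constant l_0 > 0 (depending only on q) such that for all coprime integers l and m with l_0 < l < m < 2l, there exist integers h and k with 0 < h < k < m, kl − hm = 1, and 1/2 < k·log_q(q^l − 1) − h·log_q(q^m − 1) < 1. -/

import Mathlib

theorem eight_mul_add_one_le_two_pow (n : ℕ) (hn : 6 ≤ n) : 8 * n + 1 ≤ 2 ^ n := by
  induction n, hn using Nat.le_induction with
  | base => norm_num
  | succ n hn ih => rw [pow_succ]; omega

/-- Coprime `l < m` with `1 < l` admit a Bézout relation `k * l = h * m + 1` with
`0 < h < k < m`. -/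
theorem Nat.Coprime.exists_mul_eq_mul_add_one {l m : ℕ} (hc : Nat.Coprime l m) (hl : 1 < l)
    (hlm : l < m) : ∃ h k : ℕ, 0 < h ∧ h < k ∧ k < m ∧ k * l = h * m + 1 := by
  obtain ⟨k, hkm, hk⟩ := Nat.exists_mul_mod_eq_one_of_coprime hc (by omega)
  have hdiv := Nat.div_add_mod (l * k) m
  rw [hk] at hdiv
  have hrel : k * l = (l * k / m) * m + 1 := by linarith
  generalize l * k / m = h at hrel
  refine ⟨h, k, ?_, ?_, hkm, hrel⟩
  · rcases Nat.eq_zero_or_pos h with rfl | h0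
    · have := Nat.eq_one_of_mul_eq_one_left (by simpa using hrel : k * l = 1)
      omega
    · exact h0
  · by_contra! hle
    have := Nat.mul_le_mul hle hlm.le
    omega

theorem Real.log_sub_log_sub_one_le {x : ℝ} (hx : 1 < x) :
    Real.log x - Real.log (x - 1) ≤ 1 / (x - 1) := by
  have h1 : 0 < x - 1 := by linarith
  rw [← Real.log_div (by linarith) h1.ne']
  refine (Real.log_le_sub_one_of_pos (by positivity)).trans_eq ?_
  field_simp
  ring

theorem Real.log_sub_log_sub_one_pos {x : ℝ} (hx : 1 < x) :
    0 < Real.log x - Real.log (x - 1) :=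
  sub_pos.2 (Real.log_lt_log (by linarith) (by linarith))

theorem Real.log_sub_log_sub_one_anti {x y : ℝ} (hx : 1 < x) (hxy : x ≤ y) :
    Real.log y - Real.log (y - 1) ≤ Real.log x - Real.log (x - 1) := by
  rw [← Real.log_div (by linarith) (by linarith), ← Real.log_div (by linarith) (by linarith)]
  have hx1 : 0 < x - 1 := by linarith
  have hy1 : 0 < y - 1 := by linarith
  apply Real.log_le_log (div_pos (by linarith) hy1)
  rw [div_le_div_iff₀ hy1 hx1]
  linarith

/-- Let `q ≥ 2` be an integer. There is a constant `l₀ > 0` (depending only on `q`)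
such that for all coprime integers `l, m` with `l₀ < l < m < 2l`, there exist integers
`h, k` with `0 < h < k < m`, `k*l − h*m = 1`, and
`1/2 < k·log_q(q^l − 1) − h·log_q(q^m − 1) < 1`. -/
theorem stmt7 (q : ℕ) (hq : 2 ≤ q) :
    ∃ l₀ : ℕ, 0 < l₀ ∧ ∀ l m : ℕ, Nat.Coprime l m → l₀ < l → l < m → m < 2 * l →
      ∃ h k : ℕ, 0 < h ∧ h < k ∧ k < m ∧ k * l = h * m + 1 ∧
        1 / 2 < (k : ℝ) * Real.logb q ((q : ℝ) ^ l - 1)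
                  - (h : ℝ) * Real.logb q ((q : ℝ) ^ m - 1) ∧
        (k : ℝ) * Real.logb q ((q : ℝ) ^ l - 1)
          - (h : ℝ) * Real.logb q ((q : ℝ) ^ m - 1) < 1 := by
  have hq' : (2 : ℝ) ≤ q := by exact_mod_cast hq
  have hL : 0.69 < Real.log q :=
    (by linarith [Real.log_two_gt_d9] : (0.69 : ℝ) < Real.log 2).trans_le
      (Real.log_le_log (by norm_num) hq')
  refine ⟨6, by norm_num, fun l m hc hl hlm hml => ?_⟩
  obtain ⟨h, k, h0, hhk, hkm, hrel⟩ := hc.exists_mul_eq_mul_add_one (by omega) hlm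
  refine ⟨h, k, h0, hhk, hkm, hrel, ?_⟩
  have hpow : 8 * (l : ℝ) + 1 ≤ (q : ℝ) ^ l :=
    (by exact_mod_cast eight_mul_add_one_le_two_pow l hl.le :
      8 * (l : ℝ) + 1 ≤ (2 : ℝ) ^ l).trans (pow_le_pow_left₀ (by norm_num) hq' l)
  have hl0 : (0 : ℝ) < l := by exact_mod_cast (by omega : 0 < l)
  have hone : (1 : ℝ) < (q : ℝ) ^ l := by linarith
  have hmono : (q : ℝ) ^ l ≤ (q : ℝ) ^ m := pow_le_pow_right₀ (by linarith) hlm.le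
  have hα := Real.log_sub_log_sub_one_le hone
  have hα0 := Real.log_sub_log_sub_one_pos hone
  have hβ0 := Real.log_sub_log_sub_one_pos (hone.trans_le hmono)
  have hβα := Real.log_sub_log_sub_one_anti hone hmono
  have hh : (0 : ℝ) < h := by exact_mod_cast h0
  have hhk' : (h : ℝ) < k := by exact_mod_cast hhk
  have hk : (k : ℝ) ≤ 2 * l := by exact_mod_cast (by omega : k ≤ 2 * l)
  have hrel' : (k : ℝ) * l = h * m + 1 := by exact_mod_cast hrel
  set α := Real.log ((q : ℝ) ^ l) - Real.log ((q : ℝ) ^ l - 1) with hαdef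
  set β := Real.log ((q : ℝ) ^ m) - Real.log ((q : ℝ) ^ m - 1) with hβdef
  rw [Real.log_pow] at hαdef hβdef
  have hkα : (k : ℝ) * α ≤ 1 / 4 := by
    have hα8 : α ≤ 1 / (8 * l) :=
      hα.trans (one_div_le_one_div_of_le (by positivity) (by linarith))
    calc (k : ℝ) * α ≤ 2 * l * (1 / (8 * l)) := by gcongr
      _ = 1 / 4 := by field_simp; norm_num
  have hlt : (h : ℝ) * β < k * α :=
    (mul_le_mul_of_nonneg_left hβα hh.le).trans_lt (mul_lt_mul_of_pos_right hhk' hα0)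
  have hβpos : 0 < (h : ℝ) * β := mul_pos hh hβ0
  have hL0 : 0 < Real.log q := by linarith
  have key : (k : ℝ) * Real.logb q ((q : ℝ) ^ l - 1) - h * Real.logb q ((q : ℝ) ^ m - 1)
      = (Real.log q - k * α + h * β) / Real.log q := by
    rw [Real.logb, Real.logb, ← mul_div_assoc, ← mul_div_assoc, ← sub_div]
    congr 1
    rw [hαdef, hβdef]
    linear_combination Real.log q * hrel'
  rw [key, lt_div_iff₀ hL0, div_lt_one hL0]
  constructor <;> linarith
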